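/- arXiv:1407.6848 — 2 statements merged into one kernel-verified Lean document; each statement's English description precedes it below -/
import Mathlib

section
/- Let F be any cumulative distribution function on ℝ, let X ∼ F, and let p ∈ (0,1). Then as n → ∞, (sup_{S∈𝔖_n} VaR_p(S))/n → TVaR_p(X), where the limit may be +∞. -/
open MeasureTheory ProbabilityTheory Set Filter Topology Asymptotics

noncomputable section

/-- Generalized inverse `F⁻¹` of the CDF of the distribution `ν`:
`F⁻¹(t) = inf {x | F(x) ≥ t}` for `t ≠ 0` and `F⁻¹(0) = inf {x | F(x) > 0}`. -/
def qf (ν : Measure ℝ) (t : ℝ) : ℝ :=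
  if t = 0 then sInf {x : ℝ | 0 < (ν (Iic x)).toReal}
  else sInf {x : ℝ | t ≤ (ν (Iic x)).toReal}

/-- Extended-real-valued generalized inverse of the CDF of `ν` (so that
`F⁻¹(1) = +∞` for unbounded upper support and `F⁻¹(0) = −∞` for unbounded
lower support). -/
def qfE (ν : Measure ℝ) (t : ℝ) : EReal :=
  if t = 0 then sInf ((fun x : ℝ => (x : EReal)) '' {x : ℝ | 0 < (ν (Iic x)).toReal})
  else sInf ((fun x : ℝ => (x : EReal)) '' {x : ℝ | t ≤ (ν (Iic x)).toReal})

/-- `μ_{p,q} = (q−p)⁻¹ ∫_p^q F⁻¹(t) dt` as an extended real number. -/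
def muPQ (ν : Measure ℝ) (p q : ℝ) : EReal :=
  (((q - p)⁻¹ : ℝ) : EReal) * ((∫⁻ t in Ioo p q, ENNReal.ofReal (qf ν t) : ENNReal) : EReal)
    - (((q - p)⁻¹ : ℝ) : EReal) * ((∫⁻ t in Ioo p q, ENNReal.ofReal (-(qf ν t)) : ENNReal) : EReal)

/-- `μ_{p,q} = (q−p)⁻¹ ∫_p^q F⁻¹(t) dt` as a real number (when it is finite). -/
def muR (ν : Measure ℝ) (p q : ℝ) : ℝ := (q - p)⁻¹ * ∫ t in Ioo p q, qf ν t

/-- Value-at-Risk of a random variable `X` at level `p`: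
`VaR_p(X) = inf {x | P(X ≤ x) ≥ p}`. -/
def VaR {Ω : Type*} [MeasurableSpace Ω] (P : Measure Ω) (X : Ω → ℝ) (p : ℝ) : ℝ :=
  sInf {x : ℝ | p ≤ (P {ω | X ω ≤ x}).toReal}

/-- Expected Shortfall / Tail-Value-at-Risk at level `p`:
`TVaR_p(X) = (1−p)⁻¹ ∫_p^1 VaR_α(X) dα` (real-valued). -/
def TVaR {Ω : Type*} [MeasurableSpace Ω] (P : Measure Ω) (X : Ω → ℝ) (p : ℝ) : ℝ :=
  (1 - p)⁻¹ * ∫ α in p..(1:ℝ), VaR P X α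

/-- Extended-real-valued Tail-Value-at-Risk at level `p`, allowing the value `+∞`. -/
def TVaRE {Ω : Type*} [MeasurableSpace Ω] (P : Measure Ω) (X : Ω → ℝ) (p : ℝ) : EReal :=
  (((1 - p)⁻¹ : ℝ) : EReal) * ((∫⁻ α in Ioo p 1, ENNReal.ofReal (VaR P X α) : ENNReal) : EReal)
    - (((1 - p)⁻¹ : ℝ) : EReal) * ((∫⁻ α in Ioo p 1, ENNReal.ofReal (-(VaR P X α)) : ENNReal) : EReal)

/-- The set of values `VaR_p(S)` for `S` in the admissible risk class
`𝔖_n(F,…,F) = {X₁ + ⋯ + X_n : X_i ∼ F}` (over all atomless probability spaces). -/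
def VaRvals (ν : Measure ℝ) (n : ℕ) (p : ℝ) : Set ℝ :=
  {r | ∃ (Ω : Type) (mΩ : MeasurableSpace Ω) (P : Measure Ω) (X : Fin n → Ω → ℝ),
    IsProbabilityMeasure P ∧ (∀ i, Measure.map (X i) P = ν) ∧
    r = VaR P (fun ω => ∑ i, X i ω) p}

/-- The set of values `TVaR_p(S)` for `S` in the admissible risk class
`𝔖_n(F,…,F) = {X₁ + ⋯ + X_n : X_i ∼ F}` (over all atomless probability spaces). -/
def TVaRvals (ν : Measure ℝ) (n : ℕ) (p : ℝ) : Set ℝ :=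
  {r | ∃ (Ω : Type) (mΩ : MeasurableSpace Ω) (P : Measure Ω) (X : Fin n → Ω → ℝ),
    IsProbabilityMeasure P ∧ (∀ i, Measure.map (X i) P = ν) ∧
    r = TVaR P (fun ω => ∑ i, X i ω) p}

end

section Quantile

variable (ν : Measure ℝ) [IsProbabilityMeasure ν]

/-- Galois connection between the quantile function and the CDF. -/
theorem qf_le_iff {t : ℝ} (ht : t ∈ Ioo (0 : ℝ) 1) (x : ℝ) : qf ν t ≤ x ↔ t ≤ cdf ν x := by
  have hq : qf ν t = sInf {x : ℝ | t ≤ cdf ν x} := by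
    simp [qf, ht.1.ne', cdf_eq_real, Measure.real]
  have hne : {x : ℝ | t ≤ cdf ν x}.Nonempty :=
    ((tendsto_cdf_atTop ν).eventually (eventually_ge_nhds ht.2)).exists
  have hbdd : BddBelow {x : ℝ | t ≤ cdf ν x} := by
    obtain ⟨b, hb⟩ := ((tendsto_cdf_atBot ν).eventually (eventually_lt_nhds ht.1)).exists
    refine ⟨b, fun y hy => ?_⟩
    by_contra! h
    exact (hb.trans_le hy).not_ge (monotone_cdf ν h.le)
  rw [hq]
  refine ⟨fun h => le_trans ?_ (monotone_cdf ν h), fun h => csInf_le hbdd h⟩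
  have hc : Tendsto (cdf ν) (𝓝[>] (sInf {x : ℝ | t ≤ cdf ν x}))
      (𝓝 (cdf ν (sInf {x : ℝ | t ≤ cdf ν x}))) :=
    ((cdf ν).right_continuous _).mono Ioi_subset_Ici_self
  refine ge_of_tendsto hc ?_
  filter_upwards [self_mem_nhdsWithin] with y hy
  obtain ⟨z, hz, hzy⟩ := exists_lt_of_csInf_lt hne hy
  exact le_trans hz (monotone_cdf ν hzy.le)

theorem qf_monotoneOn : MonotoneOn (qf ν) (Ioo 0 1) := fun _ hs _ ht h =>
  (qf_le_iff ν hs _).2 (h.trans ((qf_le_iff ν ht _).1 le_rfl))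

/-- The quantile function, set to zero outside `(0, 1)`. -/
noncomputable def quantile (ν : Measure ℝ) (u : ℝ) : ℝ := (Ioo (0 : ℝ) 1).indicator (qf ν) u

theorem quantile_eq {ν : Measure ℝ} {u : ℝ} (hu : u ∈ Ioo (0 : ℝ) 1) : quantile ν u = qf ν u :=
  indicator_of_mem hu _

theorem quantile_monotoneOn : MonotoneOn (quantile ν) (Ioo 0 1) := fun _ hs _ ht h => by
  rw [quantile_eq hs, quantile_eq ht]
  exact qf_monotoneOn ν hs ht h

theorem measurable_quantile : Measurable (quantile ν) := by
  refine measurable_of_Iic fun x => ?_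
  have : quantile ν ⁻¹' Iic x
      = (Ioo 0 1 ∩ Iic (cdf ν x)) ∪ ((Ioo (0 : ℝ) 1)ᶜ ∩ {_u | 0 ≤ x}) := by
    ext u
    by_cases hu : u ∈ Ioo (0 : ℝ) 1
    · simp only [mem_preimage, quantile_eq hu, mem_Iic, qf_le_iff ν hu, mem_union, mem_inter_iff,
        hu, mem_compl_iff, not_true, true_and, false_and, or_false]
    · simp only [mem_preimage, quantile, indicator_of_notMem hu, mem_Iic, mem_union, mem_inter_iff,
        hu, mem_compl_iff, not_false_iff, true_and, false_and, false_or, mem_ofPred_eq]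
  rw [this]
  exact (measurableSet_Ioo.inter measurableSet_Iic).union
    (measurableSet_Ioo.compl.inter (MeasurableSet.const _))

theorem map_quantile : Measure.map (quantile ν) (volume.restrict (Ioo 0 1)) = ν := by
  have hfin : IsFiniteMeasure (Measure.map (quantile ν) (volume.restrict (Ioo 0 1))) :=
    Measure.isFiniteMeasure_map _ _
  refine Measure.ext_of_Iic _ _ fun x => ?_
  have h1 : quantile ν ⁻¹' Iic x ∩ Ioo 0 1 = Ioo 0 1 ∩ Iic (cdf ν x) := by
    ext u
    by_cases hu : u ∈ Ioo (0 : ℝ) 1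
    · simp only [mem_inter_iff, mem_preimage, quantile_eq hu, mem_Iic, qf_le_iff ν hu, hu, and_true,
        true_and]
    · simp only [mem_inter_iff, hu, and_false, false_and]
  rw [Measure.map_apply (measurable_quantile ν) measurableSet_Iic,
    Measure.restrict_apply (measurable_quantile ν measurableSet_Iic), h1,
    measure_congr (Ioo_ae_eq_Ioc.inter (ae_eq_refl (Iic (cdf ν x)))), Ioc_inter_Iic,
    inf_eq_right.2 (cdf_le_one ν x), Real.volume_Ioc, sub_zero, ofReal_cdf]

end Quantile

/-- The Value-at-Risk is the quantile of the law. -/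
theorem VaR_eq_qf {Ω : Type*} [MeasurableSpace Ω] {P : Measure Ω} {X : Ω → ℝ}
    (hX : AEMeasurable X P) {p : ℝ} (hp : p ≠ 0) : VaR P X p = qf (Measure.map X P) p := by
  simp only [VaR, qf, hp, if_false, Measure.map_apply_of_aemeasurable hX measurableSet_Iic]
  rfl

/-- The integral of the excess over `q` of the quantile function of `ν` on levels in `(p, r)`. -/
noncomputable def tailExcess (ν : Measure ℝ) (p r q : ℝ) : ENNReal :=
  ∫⁻ α in Ioo p r, ENNReal.ofReal (quantile ν α - q)

theorem lintegral_excess (ν : Measure ℝ) [IsProbabilityMeasure ν] {p : ℝ} (hp : p ∈ Ioo (0 : ℝ) 1) :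
    ∫⁻ x, ENNReal.ofReal (x - qf ν p) ∂ν = tailExcess ν p 1 (qf ν p) := by
  have hmap : ∫⁻ x, ENNReal.ofReal (x - qf ν p) ∂ν
      = ∫⁻ α in Ioo 0 1, ENNReal.ofReal (quantile ν α - qf ν p) := by
    rw [← lintegral_map (f := fun x => ENNReal.ofReal (x - qf ν p)) (by fun_prop)
      (measurable_quantile ν), map_quantile]
  rw [hmap, tailExcess,
    ← Ioc_union_Ioo_eq_Ioo hp.1.le hp.2, lintegral_union measurableSet_Ioo]
  · rw [setLIntegral_congr_fun measurableSet_Ioc (g := fun _ => 0), lintegral_zero, zero_add]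
    intro u hu
    have hu' : u ∈ Ioo (0 : ℝ) 1 := ⟨hu.1, hu.2.trans_lt hp.2⟩
    simp only [quantile_eq hu']
    exact ENNReal.ofReal_of_nonpos (sub_nonpos.2 (qf_monotoneOn ν hu' hp hu.2))
  · exact disjoint_left.2 fun u h1 h2 => h2.1.not_ge h1.2

theorem TVaRE_eq (ν : Measure ℝ) [IsProbabilityMeasure ν] {p : ℝ} (hp : p ∈ Ioo (0 : ℝ) 1)
    {Ω : Type*} [MeasurableSpace Ω] (P : Measure Ω)
    (X : Ω → ℝ) (hX : Measure.map X P = ν) :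
    TVaRE P X p = (qf ν p : EReal)
      + (((1 - p)⁻¹ : ℝ) : EReal) * (tailExcess ν p 1 (qf ν p) : EReal) := by
  have hm : AEMeasurable X P :=
    aemeasurable_of_map_neZero (by rw [hX]; exact ⟨IsProbabilityMeasure.ne_zero ν⟩)
  have hVaR : ∀ α ∈ Ioo p 1, VaR P X α = quantile ν α := fun α hα => by
    have hα' : α ∈ Ioo (0 : ℝ) 1 := ⟨hp.1.trans hα.1, hα.2⟩
    rw [VaR_eq_qf hm hα'.1.ne', hX, quantile_eq hα']
  have hge : ∀ α ∈ Ioo p 1, qf ν p ≤ quantile ν α := fun α hα => by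
    have hα' : α ∈ Ioo (0 : ℝ) 1 := ⟨hp.1.trans hα.1, hα.2⟩
    rw [quantile_eq hα']
    exact qf_monotoneOn ν hp hα' hα.1.le
  have hQ := measurable_quantile ν
  set q := qf ν p
  have hpos : ∫⁻ α in Ioo p 1, ENNReal.ofReal (VaR P X α)
      = ∫⁻ α in Ioo p 1, ENNReal.ofReal (quantile ν α) :=
    setLIntegral_congr_fun measurableSet_Ioo fun α hα => congrArg ENNReal.ofReal (hVaR α hα)
  have hneg : ∫⁻ α in Ioo p 1, ENNReal.ofReal (-VaR P X α)
      = ∫⁻ α in Ioo p 1, ENNReal.ofReal (-quantile ν α) :=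
    setLIntegral_congr_fun measurableSet_Ioo fun α hα =>
      congrArg (fun x => ENNReal.ofReal (-x)) (hVaR α hα)
  rw [TVaRE, hpos, hneg]
  set A := ∫⁻ α in Ioo p 1, ENNReal.ofReal (quantile ν α)
  set B := ∫⁻ α in Ioo p 1, ENNReal.ofReal (-quantile ν α)
  set I := tailExcess ν p 1 q with hI
  have hvol : volume (Ioo p 1) = ENNReal.ofReal (1 - p) := Real.volume_Ioo
  have hB : B ≤ ENNReal.ofReal (-q) * ENNReal.ofReal (1 - p) := by
    rw [← hvol, ← setLIntegral_const]
    exact setLIntegral_mono' measurableSet_Ioo fun α hα =>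
      ENNReal.ofReal_le_ofReal (neg_le_neg (hge α hα))
  have hBtop : B ≠ ⊤ := ne_top_of_le_ne_top (by finiteness) hB
  have key : I + B + ENNReal.ofReal q * ENNReal.ofReal (1 - p)
      = A + ENNReal.ofReal (-q) * ENNReal.ofReal (1 - p) := by
    rw [← hvol, ← setLIntegral_const, ← setLIntegral_const, hI, tailExcess,
      ← lintegral_add_left (by fun_prop), ← lintegral_add_right _ (by fun_prop),
      ← lintegral_add_right _ (by fun_prop)]
    refine setLIntegral_congr_fun measurableSet_Ioo fun α hα => ?_
    have h := hge α hα
    rcases le_total 0 (quantile ν α) with hx | hx <;> rcases le_total 0 q with hq | hq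
    · rw [ENNReal.ofReal_of_nonpos (p := -quantile ν α) (by linarith),
        ENNReal.ofReal_of_nonpos (p := -q) (by linarith), add_zero, add_zero,
        ← ENNReal.ofReal_add (by linarith) hq, sub_add_cancel]
    · rw [ENNReal.ofReal_of_nonpos (p := -quantile ν α) (by linarith),
        ENNReal.ofReal_of_nonpos hq, add_zero, add_zero,
        ← ENNReal.ofReal_add hx (by linarith), sub_eq_add_neg]
    · have h0 : quantile ν α = q := by linarith
      rw [h0, sub_self, ENNReal.ofReal_zero, zero_add, add_comm]
    · rw [ENNReal.ofReal_of_nonpos hx, ENNReal.ofReal_of_nonpos hq, add_zero, zero_add,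
        ← ENNReal.ofReal_add (by linarith) (by linarith)]
      congr 1
      ring
  have hp1 : 0 < 1 - p := sub_pos.2 hp.2
  have hc : 0 < (1 - p)⁻¹ := inv_pos.2 hp1
  lift B to NNReal using hBtop with b
  by_cases hItop : I = ⊤
  · have hAtop : A = ⊤ := by
      by_contra hA
      rw [hItop, top_add, top_add] at key
      exact (ENNReal.add_ne_top.2 ⟨hA, by finiteness⟩) key.symm
    rw [hAtop, hItop, EReal.coe_ennreal_top, EReal.coe_mul_top_of_pos hc]
    norm_cast
  · have hAtop : A ≠ ⊤ := by
      intro hA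
      rw [hA, top_add] at key
      exact ENNReal.add_ne_top.2 ⟨ENNReal.add_ne_top.2 ⟨hItop, by finiteness⟩, by finiteness⟩ key
    lift A to NNReal using hAtop with a
    lift I to NNReal using hItop with i
    have hr := congrArg ENNReal.toReal key
    rw [ENNReal.toReal_add (by finiteness) (by finiteness), ENNReal.toReal_add (by finiteness)
      (by finiteness), ENNReal.toReal_add (by finiteness) (by finiteness), ENNReal.toReal_mul,
      ENNReal.toReal_mul, ENNReal.toReal_ofReal hp1.le, ENNReal.toReal_ofReal',
      ENNReal.toReal_ofReal'] at hr
    simp only [ENNReal.coe_toReal] at hr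
    have hmax : max q 0 - max (-q) 0 = q := by
      rcases le_total 0 q with h | h <;> simp [h]
    simp only [EReal.coe_nnreal_eq_coe_real]
    norm_cast
    field_simp
    nlinarith

/-- Per-summand Value-at-Risk of a sum is at most the Tail-Value-at-Risk of the marginal. -/
theorem div_le_of_mem_VaRvals (ν : Measure ℝ) [IsProbabilityMeasure ν] {p : ℝ}
    (hp : p ∈ Ioo (0 : ℝ) 1) {n : ℕ} (hn : 0 < n) {v : ℝ} (hv : v ∈ VaRvals ν n p) :
    ((v / n : ℝ) : EReal) ≤ (qf ν p : EReal)
      + (((1 - p)⁻¹ : ℝ) : EReal) * (tailExcess ν p 1 (qf ν p) : EReal) := by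
  obtain ⟨Ω, mΩ, P, X, hP, hX, rfl⟩ := hv
  have hm : ∀ i, AEMeasurable (X i) P := fun i =>
    aemeasurable_of_map_neZero (by rw [hX]; exact ⟨IsProbabilityMeasure.ne_zero ν⟩)
  have hS : AEMeasurable (fun ω => ∑ i, X i ω) P := Finset.aemeasurable_fun_sum _ fun i _ => hm i
  have hmapS : IsProbabilityMeasure (Measure.map (fun ω => ∑ i, X i ω) P) :=
    Measure.isProbabilityMeasure_map hS
  have hp1 : 0 < 1 - p := sub_pos.2 hp.2
  have hn' : (0 : ℝ) < n := Nat.cast_pos.2 hn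
  rw [VaR_eq_qf hS hp.1.ne']
  set v := qf (Measure.map (fun ω => ∑ i, X i ω) P) p
  set q := qf ν p
  have hexc : ∫⁻ ω, ∑ i, ENNReal.ofReal (X i ω - q) ∂P = n * tailExcess ν p 1 q := by
    rw [lintegral_finsetSum' _ fun i _ => ((hm i).sub_const q).ennreal_ofReal]
    have : ∀ i, ∫⁻ ω, ENNReal.ofReal (X i ω - q) ∂P = tailExcess ν p 1 q := fun i => by
      rw [← lintegral_excess ν hp,
        ← lintegral_map' (f := fun x => ENNReal.ofReal (x - q)) (by fun_prop) (hm i), hX i]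
    simp [this]
  by_cases hI : tailExcess ν p 1 q = ⊤
  · rw [hI, EReal.coe_ennreal_top, EReal.coe_mul_top_of_pos (inv_pos.2 hp1),
      EReal.coe_add_top]
    exact le_top
  lift tailExcess ν p 1 q to NNReal using hI with i
  rw [EReal.coe_nnreal_eq_coe_real]
  norm_cast
  rw [div_le_iff₀ hn']
  refine le_of_forall_lt_imp_le_of_dense fun x hx => ?_
  have hcdf : P.real {ω | ∑ i, X i ω ≤ x} < p := by
    have := (not_congr (qf_le_iff (Measure.map (fun ω => ∑ i, X i ω) P) hp x)).1 hx.not_ge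
    rw [cdf_eq_real, measureReal_def, Measure.map_apply_of_aemeasurable hS measurableSet_Iic,
      not_le] at this
    exact this
  have hi0 : 0 ≤ (1 - p)⁻¹ * (i : ℝ) := mul_nonneg (inv_nonneg.2 hp1.le) i.coe_nonneg
  rcases le_total x (n * q) with hxq | hxq
  · nlinarith
  set f : Ω → ENNReal := fun ω => ∑ i, ENNReal.ofReal (X i ω - q) with hf
  have hcover : univ ⊆ {ω | ∑ i, X i ω ≤ x} ∪ {ω | ENNReal.ofReal (x - n * q) ≤ f ω} := by
    intro ω _
    rcases le_or_gt (∑ i, X i ω) x with h | h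
    · exact Or.inl h
    · refine Or.inr ?_
      calc ENNReal.ofReal (x - n * q) ≤ ENNReal.ofReal (∑ i, (X i ω - q)) := by
            apply ENNReal.ofReal_le_ofReal
            simp only [Finset.sum_sub_distrib, Finset.sum_const, Finset.card_univ,
              Fintype.card_fin, nsmul_eq_mul]
            linarith
        _ ≤ ENNReal.ofReal (∑ i, max (X i ω - q) 0) :=
            ENNReal.ofReal_le_ofReal (Finset.sum_le_sum fun i _ => le_max_left _ _)
        _ = f ω := by
            rw [ENNReal.ofReal_sum_of_nonneg fun i _ => le_max_right _ _]
            simp [hf, ENNReal.ofReal_max]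
  have hprob : 1 - p ≤ P.real {ω | ENNReal.ofReal (x - n * q) ≤ f ω} := by
    have h1 := (measureReal_mono (μ := P) hcover).trans (measureReal_union_le _ _)
    rw [probReal_univ] at h1
    linarith
  have hmarkov := mul_meas_ge_le_lintegral₀ (μ := P) (f := f)
    (Finset.aemeasurable_fun_sum _ fun i _ => ((hm i).sub_const q).ennreal_ofReal)
    (ENNReal.ofReal (x - n * q))
  rw [hexc] at hmarkov
  have hreal := ENNReal.toReal_mono (by finiteness) hmarkov
  rw [ENNReal.toReal_mul, ENNReal.toReal_mul, ENNReal.toReal_ofReal (sub_nonneg.2 hxq),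
    ENNReal.toReal_natCast, ENNReal.coe_toReal, ← measureReal_def] at hreal
  have hfin : (x - n * q) * (1 - p) ≤ n * i :=
    (mul_le_mul_of_nonneg_left hprob (sub_nonneg.2 hxq)).trans hreal
  have := (le_div_iff₀ hp1).2 hfin
  calc x = (x - n * q) + n * q := by ring
    _ ≤ n * i / (1 - p) + n * q := by gcongr
    _ = (q + (1 - p)⁻¹ * i) * n := by ring
theorem restrict_Ioc_add_sum_cells {s h : ℝ} (hs : 0 ≤ s) (hh : 0 ≤ h) (m : ℕ) :
    (volume : Measure ℝ).restrict (Ioc 0 s)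
      + ∑ k ∈ Finset.range m, volume.restrict (Ioc (s + k * h) (s + k * h + h))
      = volume.restrict (Ioc 0 (s + m * h)) := by
  induction m with
  | zero => simp
  | succ m ih =>
    have hm : 0 ≤ s + m * h := by positivity
    have he : s + ((m + 1 : ℕ) : ℝ) * h = s + m * h + h := by push_cast; ring
    have hle : s + m * h ≤ s + m * h + h := by linarith
    rw [Finset.sum_range_succ, ← add_assoc, ih, he, ← Ioc_union_Ioc_eq_Ioc hm hle,
      Measure.restrict_union (disjoint_left.2 fun u h1 h2 => h2.1.not_ge h1.2) measurableSet_Ioc]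

theorem map_add_restrict_Ioo (a h : ℝ) :
    Measure.map (fun u => a + u) (volume.restrict (Ioo 0 h)) = volume.restrict (Ioc a (a + h)) := by
  have := ((measurePreserving_add_left (volume : Measure ℝ) a).restrict_preimage
    (measurableSet_Ioo (a := a) (b := a + h))).map_eq
  rw [preimage_const_add_Ioo, sub_self, add_sub_cancel_left] at this
  rw [this, restrict_Ioo_eq_restrict_Ioc]

/-- The law on `Fin n → ℝ` which is comonotone below level `s`, and above level `s` lets the
coordinates occupy the `n` quantile cells of equal mass `h` in a random cyclic order. -/
noncomputable def cyclicCoupling (ν : Measure ℝ) (n : ℕ) [NeZero n] (s h : ℝ) :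
    Measure (Fin n → ℝ) :=
  Measure.map (fun u _ => quantile ν u) (volume.restrict (Ioc 0 s))
    + ∑ k : Fin n, Measure.map (fun u i => quantile ν (s + (k + i : Fin n) * h + u))
        (volume.restrict (Ioo 0 h))

theorem map_eval_cyclicCoupling (ν : Measure ℝ) [IsProbabilityMeasure ν] (n : ℕ) [NeZero n]
    {s h : ℝ} (hs : 0 ≤ s) (hh : 0 ≤ h) (hsh : s + n * h = 1) (i : Fin n) :
    Measure.map (fun x => x i) (cyclicCoupling ν n s h) = ν := by
  have hQ := measurable_quantile ν
  have hcell : ∀ k : Fin n, Measure.map (fun x : Fin n → ℝ => x i)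
      (Measure.map (fun u i => quantile ν (s + (k + i : Fin n) * h + u))
        (volume.restrict (Ioo 0 h)))
      = Measure.map (quantile ν) (volume.restrict
          (Ioc (s + (k + i : Fin n) * h) (s + (k + i : Fin n) * h + h))) := fun k => by
    rw [Measure.map_map (by fun_prop) (by fun_prop), ← map_add_restrict_Ioo,
      Measure.map_map hQ (by fun_prop)]
    rfl
  rw [cyclicCoupling, Measure.map_add _ _ (by fun_prop),
    Measure.map_map (by fun_prop) (by fun_prop),
    Measure.map_finset_sum (Measurable.aemeasurable (by fun_prop))]
  simp only [hcell]
  have hrot := Equiv.sum_comp (Equiv.addRight i) fun k : Fin n =>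
    Measure.map (quantile ν) (volume.restrict (Ioc (s + k * h) (s + k * h + h)))
  simp only [Equiv.coe_addRight] at hrot
  rw [hrot, Fin.sum_univ_eq_sum_range (fun k : ℕ => Measure.map (quantile ν) (volume.restrict
          (Ioc (s + k * h) (s + k * h + h)))), ← Measure.map_finset_sum hQ.aemeasurable]
  have hc : (fun x : Fin n → ℝ => x i) ∘ (fun u _ => quantile ν u) = quantile ν := rfl
  rw [hc, ← Measure.map_add _ _ hQ, restrict_Ioc_add_sum_cells hs hh, hsh,
    ← restrict_Ioo_eq_restrict_Ioc, map_quantile]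

/-- Some admissible sum has Value-at-Risk at least the lower Riemann sum of the quantile function
over the levels above any `s < p`. -/
theorem exists_mem_VaRvals_ge (ν : Measure ℝ) [IsProbabilityMeasure ν] {p : ℝ}
    (hp : p ∈ Ioo (0 : ℝ) 1) {n : ℕ} {s h : ℝ} (hs : 0 < s) (hsp : s < p)
    (hh : 0 < h) (hsh : s + n * h = 1) :
    ∃ v ∈ VaRvals ν n p, ∑ j ∈ Finset.range n, quantile ν (s + j * h) ≤ v := by
  have hn : NeZero n := ⟨by rintro rfl; simp at hsh; linarith [hp.2]⟩
  have hQ := measurable_quantile ν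
  set P := cyclicCoupling ν n s h with hPdef
  have hmap : ∀ i : Fin n, Measure.map (fun x => x i) P = ν :=
    map_eval_cyclicCoupling ν n hs.le hh.le hsh
  have hP : IsProbabilityMeasure P := ⟨by
    have := Measure.map_apply (μ := P) (measurable_pi_apply (0 : Fin n)) MeasurableSet.univ
    rw [hmap, measure_univ] at this
    exact this.symm⟩
  have hS : Measurable fun x : Fin n → ℝ => ∑ i, x i := by fun_prop
  have hmapS : IsProbabilityMeasure (Measure.map (fun x : Fin n → ℝ => ∑ i, x i) P) :=
    Measure.isProbabilityMeasure_map hS.aemeasurable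
  refine ⟨_, ⟨Fin n → ℝ, inferInstance, P, fun i x => x i, hP, hmap, rfl⟩, ?_⟩
  rw [VaR_eq_qf hS.aemeasurable hp.1.ne']
  set v := qf (Measure.map (fun x : Fin n → ℝ => ∑ i, x i) P) p
  by_contra! hlt
  have hpv := (qf_le_iff (Measure.map (fun x : Fin n → ℝ => ∑ i, x i) P) hp v).1 le_rfl
  rw [cdf_eq_real, measureReal_def, Measure.map_apply hS measurableSet_Iic] at hpv
  have hcell : ∀ k : Fin n, Measure.map (fun u i => quantile ν (s + (k + i : Fin n) * h + u))
        (volume.restrict (Ioo 0 h)) ((fun x : Fin n → ℝ => ∑ i, x i) ⁻¹' Iic v) = 0 := by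
    intro k
    rw [Measure.map_apply (by fun_prop) (hS measurableSet_Iic),
      Measure.restrict_apply' measurableSet_Ioo]
    convert measure_empty (μ := (volume : Measure ℝ))
    rw [eq_empty_iff_forall_notMem]
    rintro u ⟨h1, hu⟩
    simp only [mem_preimage, mem_Iic] at h1
    have hrot := Equiv.sum_comp (Equiv.addLeft k) fun j : Fin n => quantile ν (s + j * h + u)
    simp only [Equiv.coe_addLeft] at hrot
    rw [hrot,
      Fin.sum_univ_eq_sum_range (fun j : ℕ => quantile ν (s + j * h + u))] at h1
    refine (hlt.trans_le' h1).not_ge (Finset.sum_le_sum fun j hj => ?_)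
    have hj' : (j : ℝ) + 1 ≤ n := by exact_mod_cast Finset.mem_range.1 hj
    have hjh : 0 ≤ j * h := by positivity
    have hle : s + j * h + h ≤ 1 := by nlinarith
    exact quantile_monotoneOn ν ⟨by linarith, by linarith⟩
      ⟨by linarith [hu.1], by linarith [hu.2]⟩ (by linarith [hu.1])
  have hbound : P ((fun x : Fin n → ℝ => ∑ i, x i) ⁻¹' Iic v) ≤ ENNReal.ofReal s := by
    rw [hPdef, cyclicCoupling, Measure.add_apply, Measure.finsetSum_apply,
      Finset.sum_eq_zero fun k _ => hcell k, add_zero,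
      Measure.map_apply (by fun_prop) (hS measurableSet_Iic)]
    refine (measure_mono (subset_univ _)).trans ?_
    simp
  exact (ENNReal.toReal_le_of_le_ofReal hs.le hbound).not_gt (hsp.trans_le hpv)
theorem setLIntegral_Ioc_le_sum_of_monotoneOn {g : ℝ → ENNReal} (hg : MonotoneOn g (Ioo 0 1))
    {s h : ℝ} (hs : 0 < s) (hh : 0 ≤ h) (m : ℕ) (hm : s + m * h < 1) :
    ∫⁻ u in Ioc s (s + m * h), g u
      ≤ ∑ j ∈ Finset.range m, ENNReal.ofReal h * g (s + (j + 1 : ℕ) * h) := by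
  induction m with
  | zero => simp
  | succ m ih =>
    have he : s + ((m + 1 : ℕ) : ℝ) * h = s + m * h + h := by push_cast; ring
    have hle : s + m * h ≤ s + m * h + h := by linarith
    have hm0 : 0 ≤ m * h := by positivity
    have hsm : s ≤ s + m * h := by linarith
    rw [he] at hm
    rw [Finset.sum_range_succ, he, ← Ioc_union_Ioc_eq_Ioc hsm hle,
      lintegral_union measurableSet_Ioc (disjoint_left.2 fun u h1 h2 => h2.1.not_ge h1.2)]
    gcongr
    · exact ih (by linarith)
    · calc ∫⁻ u in Ioc (s + m * h) (s + m * h + h), g u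
          ≤ ∫⁻ u in Ioc (s + m * h) (s + m * h + h), g (s + m * h + h) :=
            setLIntegral_mono' measurableSet_Ioc fun u hu =>
              hg ⟨by linarith [hu.1], by linarith [hu.2]⟩ ⟨by linarith, hm⟩ hu.2
        _ = ENNReal.ofReal h * g (s + m * h + h) := by
            rw [setLIntegral_const, Real.volume_Ioc, add_sub_cancel_left, mul_comm]

theorem tailExcess_ne_top (ν : Measure ℝ) [IsProbabilityMeasure ν] {p r : ℝ}
    (hp : p ∈ Ioo (0 : ℝ) 1) (hr : r < 1) (q : ℝ) : tailExcess ν p r q ≠ ⊤ := by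
  rcases le_or_gt r p with hrp | hrp
  · simp [tailExcess, Ioo_eq_empty hrp.not_gt]
  refine ne_top_of_le_ne_top (b := ENNReal.ofReal (quantile ν r - q) * volume (Ioo p r))
    (by rw [Real.volume_Ioo]; finiteness) ?_
  rw [← setLIntegral_const]
  refine setLIntegral_mono' measurableSet_Ioo fun u hu => ENNReal.ofReal_le_ofReal ?_
  exact sub_le_sub_right (quantile_monotoneOn ν ⟨hp.1.trans hu.1, hu.2.trans hr⟩
    ⟨hp.1.trans hrp, hr⟩ hu.2.le) q

theorem add_tailExcess_le_sum_quantile (ν : Measure ℝ) [IsProbabilityMeasure ν] {p s h x r : ℝ}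
    (hp : p ∈ Ioo (0 : ℝ) 1) (hs : 0 < s) (hsp : s < p) (hx : x ≤ qf ν s) {n : ℕ}
    (hh : 0 < h) (hsh : s + n * h = 1) (hr : r + h ≤ 1) :
    n * x + h⁻¹ * (tailExcess ν p r (qf ν p)).toReal
      ≤ ∑ j ∈ Finset.range n, quantile ν (s + j * h) := by
  have hsI : s ∈ Ioo (0 : ℝ) 1 := ⟨hs, hsp.trans hp.2⟩
  obtain ⟨m, rfl⟩ : ∃ m, n = m + 1 :=
    Nat.exists_eq_succ_of_ne_zero (by rintro rfl; simp at hsh; linarith [hsI.2])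
  have hmh : s + m * h = 1 - h := by push_cast at hsh; linarith
  have hmem : ∀ j ∈ Finset.range (m + 1), s + j * h ∈ Ioo (0 : ℝ) 1 := fun j hj => by
    have hj' : (j : ℝ) ≤ m := by exact_mod_cast Nat.lt_succ_iff.1 (Finset.mem_range.1 hj)
    have h0 : 0 ≤ j * h := by positivity
    exact ⟨by linarith, by nlinarith⟩
  have hnonneg : ∀ j ∈ Finset.range (m + 1), 0 ≤ quantile ν (s + j * h) - x := fun j hj => by
    have h0 : 0 ≤ j * h := by positivity
    have h1 := qf_monotoneOn ν hsI (hmem j hj) (by linarith)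
    rw [quantile_eq (hmem j hj)]
    linarith
  have hxq : x ≤ qf ν p := hx.trans (qf_monotoneOn ν hsI hp hsp.le)
  set g : ℝ → ENNReal := fun u => ENNReal.ofReal (quantile ν u - x) with hg
  have hgm : MonotoneOn g (Ioo 0 1) := fun u hu w hw huw =>
    ENNReal.ofReal_le_ofReal (sub_le_sub_right (quantile_monotoneOn ν hu hw huw) x)
  have key : tailExcess ν p r (qf ν p)
      ≤ ENNReal.ofReal (h * ∑ j ∈ Finset.range (m + 1), (quantile ν (s + j * h) - x)) :=
    calc tailExcess ν p r (qf ν p) ≤ ∫⁻ u in Ioo p r, g u :=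
          lintegral_mono fun u => ENNReal.ofReal_le_ofReal (sub_le_sub_left hxq _)
      _ ≤ ∫⁻ u in Ioc s (s + m * h), g u :=
          lintegral_mono_set fun u hu => ⟨hsp.trans hu.1, by linarith [hu.2]⟩
      _ ≤ ∑ j ∈ Finset.range m, ENNReal.ofReal h * g (s + (j + 1 : ℕ) * h) :=
          setLIntegral_Ioc_le_sum_of_monotoneOn hgm hs hh.le m (by linarith)
      _ ≤ ∑ j ∈ Finset.range (m + 1), ENNReal.ofReal h * g (s + j * h) := by
          rw [Finset.sum_range_succ']
          exact le_self_add
      _ = _ := by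
          rw [← Finset.mul_sum, ENNReal.ofReal_mul hh.le, ENNReal.ofReal_sum_of_nonneg hnonneg]
  have hreal := ENNReal.toReal_le_of_le_ofReal
    (mul_nonneg hh.le (Finset.sum_nonneg hnonneg)) key
  rw [Finset.sum_sub_distrib, Finset.sum_const, Finset.card_range, nsmul_eq_mul] at hreal
  have := (inv_mul_le_iff₀ hh).2 hreal
  linarith

theorem exists_lt_add_tailExcess (ν : Measure ℝ) [IsProbabilityMeasure ν] {p L q : ℝ}
    (hp : p ∈ Ioo (0 : ℝ) 1)
    (hL : (L : EReal) < q + (((1 - p)⁻¹ : ℝ) : EReal) * (tailExcess ν p 1 q : EReal)) :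
    ∃ r < 1, L < q + (1 - p)⁻¹ * (tailExcess ν p r q).toReal := by
  have hp1 : 0 < 1 - p := sub_pos.2 hp.2
  by_contra! hcon
  have hLq : 0 ≤ L - q := by
    have h1 := hcon 0 one_pos
    have h2 : 0 ≤ (1 - p)⁻¹ * (tailExcess ν p 0 q).toReal := by positivity
    linarith
  have hunion : Ioo p 1 = ⋃ k : ℕ, Ioo p (1 - 1 / ((k : ℝ) + 1)) := by
    ext u
    simp only [mem_iUnion, mem_Ioo]
    refine ⟨fun hu => ?_, fun ⟨k, hk⟩ => ⟨hk.1, hk.2.trans (sub_lt_self _ (by positivity))⟩⟩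
    obtain ⟨k, hk⟩ := exists_nat_one_div_lt (sub_pos.2 hu.2)
    exact ⟨k, hu.1, by linarith⟩
  have hmono : Monotone fun k : ℕ => Ioo p (1 - 1 / ((k : ℝ) + 1)) := fun a b hab =>
    Ioo_subset_Ioo_right (sub_le_sub_left (Nat.one_div_le_one_div hab) _)
  have hI : tailExcess ν p 1 q ≤ ENNReal.ofReal ((1 - p) * (L - q)) := by
    rw [tailExcess, hunion, setLIntegral_iUnion_of_directed _ hmono.directed_le]
    refine iSup_le fun k => ?_
    have hk : 1 - 1 / ((k : ℝ) + 1) < 1 := sub_lt_self _ (by positivity)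
    refine (ENNReal.le_ofReal_iff_toReal_le (tailExcess_ne_top ν hp hk q)
      (mul_nonneg hp1.le hLq)).2 ?_
    rw [← inv_mul_le_iff₀ hp1]
    linarith [hcon _ hk]
  have hItop : tailExcess ν p 1 q ≠ ⊤ := ne_top_of_le_ne_top (by finiteness) hI
  rw [ENNReal.le_ofReal_iff_toReal_le hItop (mul_nonneg hp1.le hLq), ← inv_mul_le_iff₀ hp1] at hI
  rw [← EReal.coe_ennreal_toReal hItop] at hL
  norm_cast at hL
  linarith

/-- The Tail-Value-at-Risk is approached asymptotically by admissible sums. -/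
theorem eventually_exists_mem_VaRvals_gt (ν : Measure ℝ) [IsProbabilityMeasure ν] {p L : ℝ}
    (hp : p ∈ Ioo (0 : ℝ) 1)
    (hL : (L : EReal) < (qf ν p : EReal)
      + (((1 - p)⁻¹ : ℝ) : EReal) * (tailExcess ν p 1 (qf ν p) : EReal)) :
    ∀ᶠ n : ℕ in atTop, ∃ v ∈ VaRvals ν n p, L < v / n := by
  obtain ⟨r, hr, hLr⟩ := exists_lt_add_tailExcess ν hp hL
  set q := qf ν p
  set J := (tailExcess ν p r q).toReal
  obtain ⟨x, hx, hxq⟩ : ∃ x, L - (1 - p)⁻¹ * J < x ∧ x < q := exists_between (by linarith)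
  have hcont : Tendsto (fun s : ℝ => x + (1 - s)⁻¹ * J) (𝓝[<] p) (𝓝 (x + (1 - p)⁻¹ * J)) := by
    refine Tendsto.mono_left ?_ nhdsWithin_le_nhds
    have : ContinuousAt (fun s : ℝ => x + (1 - s)⁻¹ * J) p := by
      have : 1 - p ≠ 0 := (sub_pos.2 hp.2).ne'
      fun_prop (disch := assumption)
    exact this
  have hcdf : cdf ν x < p := not_le.1 ((not_congr (qf_le_iff ν hp x)).1 hxq.not_ge)
  have hlim : ∀ᶠ s in 𝓝[<] p, L < x + (1 - s)⁻¹ * J :=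
    hcont.eventually (lt_mem_nhds (by linarith))
  have hs_pos : ∀ᶠ s in 𝓝[<] p, s ∈ Ioo 0 p := Ioo_mem_nhdsLT hp.1
  have hs_cdf : ∀ᶠ s in 𝓝[<] p, s ∈ Ioo (cdf ν x) p := Ioo_mem_nhdsLT hcdf
  obtain ⟨s, hsL, ⟨hs0, hsp⟩, hxs, -⟩ := (hlim.and (hs_pos.and hs_cdf)).exists
  have hs1 : s < 1 := hsp.trans hp.2
  have hxs' : x ≤ qf ν s := (not_le.1 ((not_congr (qf_le_iff ν ⟨hs0, hs1⟩ x)).2 hxs.not_ge)).le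
  have hsmall : ∀ᶠ n : ℕ in atTop, (1 - s) / n < 1 - r :=
    (tendsto_const_div_atTop_nhds_zero_nat (1 - s)).eventually (gt_mem_nhds (sub_pos.2 hr))
  filter_upwards [hsmall, eventually_gt_atTop 0] with n hnr hn
  have hn' : (0 : ℝ) < n := Nat.cast_pos.2 hn
  have hh : 0 < (1 - s) / n := div_pos (sub_pos.2 hs1) hn'
  have hsh : s + n * ((1 - s) / n) = 1 := by rw [mul_div_cancel₀ _ hn'.ne']; ring
  obtain ⟨v, hv, hle⟩ := exists_mem_VaRvals_ge ν hp hs0 hsp hh hsh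
  refine ⟨v, hv, hsL.trans_le ((le_div_iff₀ hn').2 ?_)⟩
  calc (x + (1 - s)⁻¹ * J) * n = n * x + ((1 - s) / n)⁻¹ * J := by rw [inv_div]; ring
    _ ≤ v := (add_tailExcess_le_sum_quantile ν hp hs0 hsp hxs' hh hsh (by linarith)).trans hle

/-- **Corollary 3.4.** For any distribution `F`, `X ∼ F` and `p ∈ (0,1)`,
`(sup_{S ∈ 𝔖_n} VaR_p(S)) / n → TVaR_p(X)` as `n → ∞`, where the limit (an extended
real number) may be `+∞`. -/
theorem sup_VaR_div_n_tendsto_TVaR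
    (ν : Measure ℝ) [IsProbabilityMeasure ν] (p : ℝ) (hp : p ∈ Ioo (0:ℝ) 1)
    {Ω : Type*} [MeasurableSpace Ω] (P : Measure Ω) [IsProbabilityMeasure P]
    (X : Ω → ℝ) (hX : Measure.map X P = ν) :
    Tendsto
      (fun n : ℕ => sSup ((fun r : ℝ => ((r / (n : ℝ) : ℝ) : EReal)) '' VaRvals ν n p))
      atTop (nhds (TVaRE P X p)) := by
  rw [TVaRE_eq ν hp P X hX]
  refine tendsto_order.2 ⟨fun a ha => ?_, fun a ha => ?_⟩
  · obtain ⟨L, haL, hL⟩ := EReal.lt_iff_exists_real_btwn.1 ha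
    filter_upwards [eventually_exists_mem_VaRvals_gt ν hp hL] with n ⟨v, hv, hLv⟩
    exact (haL.trans (EReal.coe_lt_coe_iff.2 hLv)).trans_le (le_sSup (mem_image_of_mem _ hv))
  · filter_upwards [eventually_gt_atTop 0] with n hn
    refine lt_of_le_of_lt (sSup_le ?_) ha
    rintro _ ⟨v, hv, rfl⟩
    exact div_le_of_mem_VaRvals ν hp hn hv
end

section
/- Let F be a cumulative distribution function on ℝ with finite k-th absolute moment for some k ≥ 1, let X ∼ F, and let p ∈ (0,1) be such that TVaR_p(X) ≠ 0. Then as n → ∞, (sup_{S∈𝔖_n} VaR_p(S))/(sup_{S∈𝔖_n} TVaR_p(S)) = 1 − o(n^{−1+1/k}); in particular the worst-case VaR and the worst-case TVaR over 𝔖_n are asymptotically equivalent. -/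
open MeasureTheory ProbabilityTheory Set Filter Topology Asymptotics

/-- The left-continuous quantile function of a measure on `ℝ`. -/
noncomputable def leftQuantile (μ : Measure ℝ) (t : ℝ) : ℝ := sInf {x : ℝ | t ≤ cdf μ x}

lemma leftQuantile_le_iff (μ : Measure ℝ) {t : ℝ} (ht : t ∈ Ioo (0 : ℝ) 1) (x : ℝ) :
    leftQuantile μ t ≤ x ↔ t ≤ cdf μ x := by
  have hne : {x : ℝ | t ≤ cdf μ x}.Nonempty :=
    ((tendsto_cdf_atTop μ).eventually (eventually_ge_nhds ht.2)).exists
  have hbdd : BddBelow {x : ℝ | t ≤ cdf μ x} := by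
    obtain ⟨b, hb⟩ := ((tendsto_cdf_atBot μ).eventually (eventually_lt_nhds ht.1)).exists
    refine ⟨b, fun y hy => le_of_not_gt fun h => ?_⟩
    exact (hb.trans_le hy).not_ge (monotone_cdf μ h.le)
  refine ⟨fun h => ?_, fun h => csInf_le hbdd h⟩
  have key : ∀ y, x < y → t ≤ cdf μ y := by
    intro y hy
    obtain ⟨z, hz, hzy⟩ := exists_lt_of_csInf_lt hne (h.trans_lt hy)
    exact le_trans hz (monotone_cdf μ hzy.le)
  have hc : Tendsto (cdf μ) (𝓝[>] x) (𝓝 (cdf μ x)) :=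
    ((cdf μ).right_continuous x).mono Ioi_subset_Ici_self
  exact ge_of_tendsto hc (eventually_nhdsWithin_of_forall key)

lemma monotoneOn_leftQuantile (μ : Measure ℝ) : MonotoneOn (leftQuantile μ) (Ioo 0 1) := by
  intro s hs t ht hst
  rw [leftQuantile_le_iff μ hs]
  exact hst.trans ((leftQuantile_le_iff μ ht _).1 le_rfl)

lemma aemeasurable_leftQuantile (μ : Measure ℝ) :
    AEMeasurable (leftQuantile μ) (volume.restrict (Ioo 0 1)) :=
  aemeasurable_restrict_of_monotoneOn measurableSet_Ioo (monotoneOn_leftQuantile μ)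

instance isProbabilityMeasure_restrict_Ioo :
    IsProbabilityMeasure ((volume : Measure ℝ).restrict (Ioo 0 1)) :=
  ⟨by simp⟩

lemma map_leftQuantile (μ : Measure ℝ) [IsProbabilityMeasure μ] :
    Measure.map (leftQuantile μ) (volume.restrict (Ioo 0 1)) = μ := by
  have hm := aemeasurable_leftQuantile μ
  have := Measure.isProbabilityMeasure_map hm
  refine Measure.ext_of_Iic _ _ fun x => ?_
  rw [Measure.map_apply_of_aemeasurable hm measurableSet_Iic, ← ofReal_cdf,
    Measure.restrict_apply₀' measurableSet_Ioo.nullMeasurableSet]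
  have h : leftQuantile μ ⁻¹' Iic x ∩ Ioo 0 1 = Iic (cdf μ x) ∩ Ioo 0 1 := by
    ext t
    simp only [mem_inter_iff, mem_preimage, mem_Iic]
    exact and_congr_left fun ht => leftQuantile_le_iff μ ht x
  have h0 := cdf_nonneg μ x
  have h1 := cdf_le_one μ x
  rw [h]
  refine le_antisymm ?_ ?_
  · calc volume (Iic (cdf μ x) ∩ Ioo 0 1) ≤ volume (Ioc 0 (cdf μ x)) :=
          measure_mono fun t ht => ⟨ht.2.1, ht.1⟩
      _ = _ := by simp
  · calc _ = volume (Ioo 0 (cdf μ x)) := by simp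
      _ ≤ volume (Iic (cdf μ x) ∩ Ioo 0 1) :=
          measure_mono fun t ht => ⟨ht.2.le, ht.1, ht.2.trans_le h1⟩

lemma integral_comp_leftQuantile (μ : Measure ℝ) [IsProbabilityMeasure μ] {g : ℝ → ℝ}
    (hg : AEStronglyMeasurable g μ) :
    ∫ t in Ioo 0 1, g (leftQuantile μ t) = ∫ x, g x ∂μ := by
  conv_rhs => rw [← map_leftQuantile μ]
  rw [integral_map (aemeasurable_leftQuantile μ) (by rwa [map_leftQuantile μ])]

lemma integrableOn_comp_leftQuantile (μ : Measure ℝ) [IsProbabilityMeasure μ] {g : ℝ → ℝ}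
    (hg : Integrable g μ) :
    IntegrableOn (fun t => g (leftQuantile μ t)) (Ioo 0 1) := by
  rw [← map_leftQuantile μ] at hg
  exact hg.comp_aemeasurable (aemeasurable_leftQuantile μ)

lemma VaR_eq_leftQuantile {Ω : Type*} [MeasurableSpace Ω] (P : Measure Ω) [IsProbabilityMeasure P]
    {S : Ω → ℝ} (hS : AEMeasurable S P) : VaR P S = leftQuantile (Measure.map S P) := by
  have := Measure.isProbabilityMeasure_map hS
  ext t
  unfold VaR leftQuantile
  simp_rw [cdf_eq_real, measureReal_def, Measure.map_apply_of_aemeasurable hS measurableSet_Iic]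
  rfl

lemma TVaR_eq_integral {Ω : Type*} [MeasurableSpace Ω] (P : Measure Ω) [IsProbabilityMeasure P]
    {S : Ω → ℝ} (hS : AEMeasurable S P) {p : ℝ} (hp : p ∈ Ioo (0 : ℝ) 1) :
    TVaR P S p = (1 - p)⁻¹ * ∫ t in Ioo p 1, leftQuantile (Measure.map S P) t := by
  rw [TVaR, VaR_eq_leftQuantile P hS, intervalIntegral.integral_of_le hp.2.le,
    integral_Ioc_eq_integral_Ioo]

/-- The minimization formula for the upper tail integral of the quantile function: upper bound. -/
lemma integral_leftQuantile_le (μ : Measure ℝ) [IsProbabilityMeasure μ]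
    (hμ : Integrable id μ) {p : ℝ} (hp : p ∈ Ioo (0 : ℝ) 1) (x : ℝ) :
    ∫ t in Ioo p 1, leftQuantile μ t ≤ (1 - p) * x + ∫ y, max (y - x) 0 ∂μ := by
  have hi : Integrable (fun y => max (y - x) 0) μ :=
    (hμ.sub (integrable_const x)).pos_part
  have hi' := integrableOn_comp_leftQuantile μ hi
  have hQ : IntegrableOn (leftQuantile μ) (Ioo 0 1) := integrableOn_comp_leftQuantile μ hμ
  have hsub : Ioo p 1 ⊆ Ioo 0 1 := Ioo_subset_Ioo_left hp.1.le
  calc ∫ t in Ioo p 1, leftQuantile μ t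
      ≤ ∫ t in Ioo p 1, (x + max (leftQuantile μ t - x) 0) := by
        refine integral_mono (hQ.mono_set hsub)
          ((integrable_const x).add (hi'.mono_set hsub)) fun t => ?_
        have := le_max_left (leftQuantile μ t - x) 0
        dsimp only
        linarith
    _ = (1 - p) * x + ∫ t in Ioo p 1, max (leftQuantile μ t - x) 0 := by
        rw [integral_add (integrable_const x) (hi'.mono_set hsub)]
        simp [hp.2.le]
    _ ≤ (1 - p) * x + ∫ t in Ioo 0 1, max (leftQuantile μ t - x) 0 := by
        refine add_le_add_right ?_ _
        exact setIntegral_mono_set hi' (.of_forall fun t => le_max_right _ _) hsub.eventuallyLE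
    _ = _ := by rw [integral_comp_leftQuantile μ hi.1]

/-- The minimum in the minimization formula is attained at the quantile. -/
lemma integral_leftQuantile_eq (μ : Measure ℝ) [IsProbabilityMeasure μ]
    (hμ : Integrable id μ) {p : ℝ} (hp : p ∈ Ioo (0 : ℝ) 1) :
    ∫ t in Ioo p 1, leftQuantile μ t
      = (1 - p) * leftQuantile μ p + ∫ y, max (y - leftQuantile μ p) 0 ∂μ := by
  set x := leftQuantile μ p with hx
  have hi : Integrable (fun y => max (y - x) 0) μ :=
    (hμ.sub (integrable_const x)).pos_part
  have hi' := integrableOn_comp_leftQuantile μ hi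
  have hsub : Ioo p 1 ⊆ Ioo 0 1 := Ioo_subset_Ioo_left hp.1.le
  have h0 : ∀ t ∈ Ioo (0 : ℝ) 1 \ Ioo p 1, max (leftQuantile μ t - x) 0 = 0 := by
    rintro t ⟨ht, htp⟩
    have : t ≤ p := le_of_not_gt fun h => htp ⟨h, ht.2⟩
    exact max_eq_right (sub_nonpos.2 (monotoneOn_leftQuantile μ ht hp this))
  rw [← integral_comp_leftQuantile μ hi.1, setIntegral_eq_of_subset_of_forall_sdiff_eq_zero
    measurableSet_Ioo hsub h0]
  have h1 : ∀ t ∈ Ioo p 1, leftQuantile μ t = x + max (leftQuantile μ t - x) 0 := by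
    intro t ht
    rw [max_eq_left (sub_nonneg.2 (monotoneOn_leftQuantile μ hp (hsub ht) ht.1.le))]
    ring
  rw [setIntegral_congr_fun measurableSet_Ioo h1,
    integral_add (integrable_const x) (hi'.mono_set hsub)]
  simp [hp.2.le]

lemma leftQuantile_le_tail_average (μ : Measure ℝ) [IsProbabilityMeasure μ]
    (hμ : Integrable id μ) {p : ℝ} (hp : p ∈ Ioo (0 : ℝ) 1) :
    leftQuantile μ p ≤ (1 - p)⁻¹ * ∫ t in Ioo p 1, leftQuantile μ t := by
  have h1p : 0 < 1 - p := sub_pos.2 hp.2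
  rw [integral_leftQuantile_eq μ hμ hp, inv_mul_eq_div, le_div_iff₀ h1p]
  have : 0 ≤ ∫ y, max (y - leftQuantile μ p) 0 ∂μ := integral_nonneg fun y => le_max_right _ _
  linarith

/-- Subadditivity of the upper tail integral for identically distributed summands. -/
lemma integral_leftQuantile_sum_le {Ω : Type*} [MeasurableSpace Ω] (P : Measure Ω)
    [IsProbabilityMeasure P] (ν : Measure ℝ) [IsProbabilityMeasure ν] (hν : Integrable id ν)
    {n : ℕ} {X : Fin n → Ω → ℝ} (hm : ∀ i, AEMeasurable (X i) P)
    (hX : ∀ i, Measure.map (X i) P = ν) {p : ℝ} (hp : p ∈ Ioo (0 : ℝ) 1) :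
    Integrable id (Measure.map (fun ω => ∑ i, X i ω) P) ∧
    ∫ t in Ioo p 1, leftQuantile (Measure.map (fun ω => ∑ i, X i ω) P) t
      ≤ n * ∫ t in Ioo p 1, leftQuantile ν t := by
  have hS : AEMeasurable (fun ω => ∑ i, X i ω) P := Finset.aemeasurable_fun_sum _ fun i _ => hm i
  have hXi : ∀ {g : ℝ → ℝ}, Integrable g ν → ∀ i, Integrable (fun ω => g (X i ω)) P := by
    intro g hg i
    rw [← hX i] at hg
    exact hg.comp_aemeasurable (hm i)
  have hSi : Integrable (fun ω => ∑ i, X i ω) P := integrable_finsetSum _ fun i _ => hXi hν i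
  have hSid : Integrable id (Measure.map (fun ω => ∑ i, X i ω) P) :=
    (integrable_map_measure aestronglyMeasurable_id hS).2 hSi
  have := Measure.isProbabilityMeasure_map hS
  refine ⟨hSid, ?_⟩
  set x := leftQuantile ν p with hx
  have hpos : Integrable (fun y => max (y - x) 0) ν := (hν.sub (integrable_const x)).pos_part
  calc _ ≤ (1 - p) * (n * x) + ∫ y, max (y - n * x) 0 ∂(Measure.map (fun ω => ∑ i, X i ω) P) :=
        integral_leftQuantile_le _ hSid hp _
    _ = (1 - p) * (n * x) + ∫ ω, max (∑ i, X i ω - n * x) 0 ∂P := by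
        rw [integral_map hS (by fun_prop)]
    _ ≤ (1 - p) * (n * x) + ∫ ω, ∑ i, max (X i ω - x) 0 ∂P := by
        refine add_le_add_right ?_ _
        refine integral_mono (hSi.sub (integrable_const _)).pos_part
          (integrable_finsetSum _ fun i _ => hXi hpos i) fun ω => ?_
        refine max_le ?_ (Finset.sum_nonneg fun i _ => le_max_right _ _)
        calc ∑ i, X i ω - n * x = ∑ i, (X i ω - x) := by simp
          _ ≤ _ := Finset.sum_le_sum fun i _ => le_max_left _ _
    _ = (1 - p) * (n * x) + ∑ i : Fin n, ∫ y, max (y - x) 0 ∂ν := by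
        rw [integral_finsetSum _ fun i _ => hXi hpos i]
        congr 1
        refine Finset.sum_congr rfl fun i _ => ?_
        rw [← hX i, integral_map (hm i) (by fun_prop)]
    _ = _ := by
        rw [integral_leftQuantile_eq ν hν hp]
        simp
        ring

lemma leftQuantile_map_const_mul (ν : Measure ℝ) [IsProbabilityMeasure ν] {c : ℝ} (hc : 0 < c)
    {t : ℝ} (ht : t ∈ Ioo (0 : ℝ) 1) :
    leftQuantile (Measure.map (fun x => c * x) ν) t = c * leftQuantile ν t := by
  have hm : Measurable fun x : ℝ => c * x := by fun_prop
  have := Measure.isProbabilityMeasure_map (μ := ν) hm.aemeasurable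
  refine eq_of_forall_ge_iff fun x => ?_
  rw [leftQuantile_le_iff _ ht, ← le_div_iff₀' hc, leftQuantile_le_iff _ ht, cdf_eq_real,
    cdf_eq_real, measureReal_def, measureReal_def, Measure.map_apply hm measurableSet_Iic]
  have : (fun x => c * x) ⁻¹' Iic x = Iic (x / c) := by
    ext y
    simp [le_div_iff₀' hc]
  rw [this]

/-- The worst-case TVaR is attained by the comonotonic scenario. -/
lemma isGreatest_TVaRvals (ν : Measure ℝ) [IsProbabilityMeasure ν] (hν : Integrable id ν)
    {n : ℕ} (hn : 0 < n) {p : ℝ} (hp : p ∈ Ioo (0 : ℝ) 1) :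
    IsGreatest (TVaRvals ν n p) (n * ((1 - p)⁻¹ * ∫ t in Ioo p 1, leftQuantile ν t)) := by
  have h1p : 0 < 1 - p := sub_pos.2 hp.2
  constructor
  · refine ⟨ℝ, inferInstance, ν, fun _ x => x, inferInstance, fun _ => Measure.map_id, ?_⟩
    simp only [Finset.sum_const, Finset.card_univ, Fintype.card_fin, nsmul_eq_mul]
    rw [TVaR_eq_integral ν (by fun_prop) hp, setIntegral_congr_fun measurableSet_Ioo fun t ht =>
      leftQuantile_map_const_mul ν (Nat.cast_pos.2 hn) ⟨hp.1.trans ht.1, ht.2⟩, integral_const_mul]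
    ring
  · rintro r ⟨Ω, mΩ, P, X, hP, hX, rfl⟩
    have hm : ∀ i, AEMeasurable (X i) P := fun i =>
      AEMeasurable.of_map_ne_zero (by rw [hX i]; exact IsProbabilityMeasure.ne_zero ν)
    rw [TVaR_eq_integral P (Finset.aemeasurable_fun_sum _ fun i _ => hm i) hp, mul_left_comm]
    gcongr
    exact (integral_leftQuantile_sum_le P ν hν hm hX hp).2

lemma VaRvals_le (ν : Measure ℝ) [IsProbabilityMeasure ν] (hν : Integrable id ν)
    (n : ℕ) {p : ℝ} (hp : p ∈ Ioo (0 : ℝ) 1) {r : ℝ} (hr : r ∈ VaRvals ν n p) :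
    r ≤ n * ((1 - p)⁻¹ * ∫ t in Ioo p 1, leftQuantile ν t) := by
  obtain ⟨Ω, mΩ, P, X, hP, hX, rfl⟩ := hr
  have h1p : 0 < 1 - p := sub_pos.2 hp.2
  have hm : ∀ i, AEMeasurable (X i) P := fun i =>
    AEMeasurable.of_map_ne_zero (by rw [hX i]; exact IsProbabilityMeasure.ne_zero ν)
  have hS : AEMeasurable (fun ω => ∑ i, X i ω) P := Finset.aemeasurable_fun_sum _ fun i _ => hm i
  have := Measure.isProbabilityMeasure_map hS
  obtain ⟨hi, hle⟩ := integral_leftQuantile_sum_le P ν hν hm hX hp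
  rw [VaR_eq_leftQuantile P hS, mul_left_comm]
  refine (leftQuantile_le_tail_average _ hi hp).trans ?_
  gcongr

lemma measurePreserving_coe_addCircle_Ico {T : ℝ} [hT : Fact (0 < T)] (a : ℝ) :
    MeasurePreserving (β := AddCircle T) ((↑) : ℝ → AddCircle T)
      (volume.restrict (Ico a (a + T))) volume := by
  rw [restrict_Ico_eq_restrict_Ioc]
  exact AddCircle.measurePreserving_mk T a

lemma measurePreserving_coe_equivIco {T : ℝ} [hT : Fact (0 < T)] (a : ℝ) :
    MeasurePreserving (fun y : AddCircle T => (AddCircle.equivIco T a y : ℝ)) volume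
      (volume.restrict (Ico a (a + T))) := by
  have hφ : Measurable fun y : AddCircle T => (AddCircle.equivIco T a y : ℝ) := by
    have h := (AddCircle.measurableEquivIco T a).measurable
    exact h.subtype_val
  refine ⟨hφ, ?_⟩
  have hmk := measurePreserving_coe_addCircle_Ico (T := T) a
  rw [← hmk.map_eq, Measure.map_map hφ hmk.measurable]
  conv_rhs => rw [← Measure.map_id (μ := volume.restrict (Ico a (a + T)))]
  refine Measure.map_congr ?_
  filter_upwards [ae_restrict_mem measurableSet_Ico] with u hu
  exact congrArg Subtype.val (AddCircle.equivIco_coe_eq hu)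

lemma measurePreserving_toIcoMod_add {T : ℝ} (hT : 0 < T) (a c : ℝ) :
    MeasurePreserving (fun u => toIcoMod hT a (u + c)) (volume.restrict (Ico a (a + T)))
      (volume.restrict (Ico a (a + T))) := by
  have : Fact (0 < T) := ⟨hT⟩
  have h := (measurePreserving_coe_equivIco a).comp
    ((measurePreserving_add_right volume (c : AddCircle T)).comp
      (measurePreserving_coe_addCircle_Ico a))
  exact h

/-- A sum of a monotone function over a rotated lattice dominates a lower Riemann-type integral. -/
lemma sum_toIcoMod_ge {f : ℝ → ℝ} {a T : ℝ} (hT : 0 < T) (hf : MonotoneOn f (Ico a (a + T)))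
    (hfi : IntegrableOn f (Ioc a (a + T))) {n : ℕ} (hn : 0 < n) (u : ℝ) :
    n / T * (∫ x in a..(a + T - T / n), f x) + f a
      ≤ ∑ i : Fin n, f (toIcoMod hT a (u + i * (T / n))) := by
  have hn' : (1 : ℝ) ≤ n := by exact_mod_cast hn
  have hn0 : (0 : ℝ) < n := by linarith
  set d := T / n with hd
  have hd0 : 0 < d := div_pos hT hn0
  have hdT : d ≤ T := div_le_self hT.le hn'
  have hnd : n * d = T := by rw [hd]; field_simp
  set b := a + T - d with hb
  set h : ℝ → ℝ := (Iio b).piecewise f fun _ => f a with hh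
  set g : ℝ → ℝ := fun y => h (toIcoMod hT a y) with hg
  have hper : Function.Periodic g T := fun y => by
    simp only [hg, toIcoMod_add_right]
  have hhint : IntegrableOn h (Ioc a (a + T)) :=
    Integrable.piecewise measurableSet_Iio hfi.integrableOn (integrable_const _).integrableOn
  have hgh : ∀ y ∈ Ico a (a + T), g y = h y := fun y hy => by
    simp only [hg, (toIcoMod_eq_self hT).2 hy]
  have hghI : IntegrableOn g (Ioc a (a + T)) := by
    rw [IntegrableOn, ← restrict_Ico_eq_restrict_Ioc] at hhint ⊢
    exact IntegrableOn.congr_fun hhint (fun y hy => (hgh y hy).symm) measurableSet_Ico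
  have hgint : ∀ s t, IntervalIntegrable g volume s t :=
    hper.intervalIntegrable hT.ne' ((intervalIntegrable_iff_integrableOn_Ioc_of_le (by linarith)).2 hghI)
  have hle : ∀ x y, x - d < y → y ≤ x → g y ≤ f (toIcoMod hT a x) := by
    intro x y hxy hyx
    have hw := toIcoMod_mem_Ico hT a x
    have hxw : x = toIcoMod hT a x + toIcoDiv hT a x * T := (toIcoMod_add_toIcoDiv_mul hT a x).symm
    set w := toIcoMod hT a x
    have haw : f a ≤ f w := hf ⟨le_rfl, by linarith⟩ hw hw.1
    simp only [hg]
    by_cases hc : a ≤ w - (x - y)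
    · have hv : w - (x - y) ∈ Ico a (a + T) := ⟨hc, by linarith [hw.2]⟩
      have : toIcoMod hT a y = w - (x - y) :=
        (toIcoMod_eq_iff hT).2 ⟨hv, toIcoDiv hT a x, by rw [zsmul_eq_mul]; linarith⟩
      rw [this, hh, Set.piecewise]
      split_ifs
      · exact hf hv hw (by linarith)
      · exact haw
    · have hv : w - (x - y) + T ∈ Ico a (a + T) := ⟨by linarith [hw.1], by linarith⟩
      have : toIcoMod hT a y = w - (x - y) + T :=
        (toIcoMod_eq_iff hT).2 ⟨hv, toIcoDiv hT a x - 1, by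
          rw [zsmul_eq_mul]; push_cast; linarith⟩
      rw [this, hh, Set.piecewise_eq_of_notMem]
      · exact haw
      · rw [mem_Iio, not_lt]
        linarith [hw.1]
  have hstep : ∀ x, ∫ y in (x - d)..x, g y ≤ d * f (toIcoMod hT a x) := by
    intro x
    have := intervalIntegral.integral_mono_on_of_le_Ioo (μ := volume) (by linarith : x - d ≤ x)
      (hgint _ _) (intervalIntegrable_const (c := f (toIcoMod hT a x)))
      fun y hy => hle x y hy.1 hy.2.le
    simpa using this
  have hsum : ∑ i ∈ Finset.range n, ∫ y in (u + i * d - d)..(u + i * d), g y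
      = ∫ y in a..(a + T), g y := by
    have h1 := intervalIntegral.sum_integral_adjacent_intervals (f := g) (μ := volume)
      (a := fun i : ℕ => u + i * d - d) (n := n) fun i _ => hgint _ _
    rw [← hper.intervalIntegral_add_eq (u - d) a]
    convert h1 using 2
    · congr 1
      push_cast
      ring
    · simp
    · rw [hnd]; ring
  have hfin : ∫ y in a..(a + T), g y = (∫ x in a..b, f x) + d * f a := by
    rw [← intervalIntegral.integral_add_adjacent_intervals (hgint a b) (hgint b (a + T))]
    have hab : a ≤ b := by linarith
    have hbT : b ≤ a + T := by linarith
    congr 1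
    · refine intervalIntegral.integral_congr_Ioo_of_le hab fun y hy => ?_
      rw [hgh y ⟨hy.1.le, hy.2.trans_le hbT⟩, hh, Set.piecewise_eq_of_mem _ _ _ (mem_Iio.2 hy.2)]
    · have : ∫ y in b..(a + T), g y = ∫ y in b..(a + T), f a := by
        refine intervalIntegral.integral_congr_Ioo_of_le hbT fun y hy => ?_
        rw [hgh y ⟨hab.trans hy.1.le, hy.2⟩, hh, Set.piecewise_eq_of_notMem]
        exact not_lt.2 hy.1.le
      rw [this, intervalIntegral.integral_const, smul_eq_mul]
      congr 1
      linarith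
  have hmain : (∫ x in a..b, f x) + d * f a ≤ d * ∑ i : Fin n, f (toIcoMod hT a (u + i * d)) := by
    rw [Fin.sum_univ_eq_sum_range fun i => f (toIcoMod hT a (u + i * d)), Finset.mul_sum, ← hfin,
      ← hsum]
    exact Finset.sum_le_sum fun i _ => hstep _
  have hnT : (n : ℝ) / T * d = 1 := by rw [hd]; field_simp
  calc n / T * (∫ x in a..b, f x) + f a = n / T * ((∫ x in a..b, f x) + d * f a) := by
        rw [mul_add, ← mul_assoc, hnT, one_mul]
    _ ≤ n / T * (d * ∑ i : Fin n, f (toIcoMod hT a (u + i * d))) := by gcongr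
    _ = _ := by rw [← mul_assoc, hnT, one_mul]

/-- Rotating the upper tail `[a, 1)` preserves the uniform distribution on `(0, 1)`. -/
lemma measurePreserving_rotate_tail {a T : ℝ} (ha : 0 < a) (hT : 0 < T) (haT : a + T = 1) (c : ℝ) :
    MeasurePreserving (fun u => if u < a then u else toIcoMod hT a (u + c))
      (volume.restrict (Ioo 0 1)) (volume.restrict (Ioo 0 1)) := by
  have hrot := measurePreserving_toIcoMod_add hT a c
  rw [haT] at hrot
  have hm : Measurable fun u => if u < a then u else toIcoMod hT a (u + c) :=
    Measurable.ite measurableSet_Iio measurable_id hrot.measurable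
  refine ⟨hm, ?_⟩
  have hsplit : (volume : Measure ℝ).restrict (Ioo 0 1)
      = volume.restrict (Ioo 0 a) + volume.restrict (Ico a 1) := by
    rw [← Measure.restrict_union _ measurableSet_Ico, Ioo_union_Ico_eq_Ioo ha (by linarith)]
    exact Set.disjoint_left.2 fun x hx hx' => hx.2.not_ge hx'.1
  rw [hsplit, Measure.map_add _ _ hm]
  congr 1
  · conv_rhs => rw [← Measure.map_id (μ := volume.restrict (Ioo 0 a))]
    refine Measure.map_congr ?_
    filter_upwards [ae_restrict_mem measurableSet_Ioo] with u hu
    simp [hu.2]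
  · refine (Measure.map_congr ?_).trans hrot.map_eq
    filter_upwards [ae_restrict_mem measurableSet_Ico] with u hu
    simp [hu.1]

lemma exists_VaRvals_ge (ν : Measure ℝ) [IsProbabilityMeasure ν] (hν : Integrable id ν)
    {n : ℕ} (hn : 0 < n) {p a : ℝ} (hp : p ∈ Ioo (0 : ℝ) 1) (ha : 0 < a) (hap : a < p) :
    ∃ r ∈ VaRvals ν n p,
      n / (1 - a) * (∫ x in a..(1 - (1 - a) / n), leftQuantile ν x) + leftQuantile ν a ≤ r := by
  obtain ⟨T, haT⟩ : ∃ T, a + T = 1 := ⟨1 - a, by ring⟩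
  have hT : 0 < T := by linarith [hp.2]
  have hT' : 1 - a = T := by linarith
  have hQ : IntegrableOn (leftQuantile ν) (Ioo 0 1) := integrableOn_comp_leftQuantile ν hν
  have hσ := fun i : Fin n => measurePreserving_rotate_tail ha hT haT (i * (T / n))
  set P : Measure ℝ := volume.restrict (Ioo 0 1) with hP
  set X : Fin n → ℝ → ℝ := fun i u =>
    leftQuantile ν (if u < a then u else toIcoMod hT a (u + i * (T / n))) with hX
  have hXm : ∀ i, AEMeasurable (X i) P := fun i =>
    (aemeasurable_leftQuantile ν).comp_quasiMeasurePreserving (hσ i).quasiMeasurePreserving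
  have hXν : ∀ i, Measure.map (X i) P = ν := by
    intro i
    have hQ' : AEMeasurable (leftQuantile ν) (Measure.map
        (fun u => if u < a then u else toIcoMod hT a (u + i * (T / n))) P) := by
      rw [(hσ i).map_eq]
      exact aemeasurable_leftQuantile ν
    have := AEMeasurable.map_map_of_aemeasurable hQ' (hσ i).measurable.aemeasurable
    rw [(hσ i).map_eq, map_leftQuantile] at this
    exact this.symm
  have hS : AEMeasurable (fun u => ∑ i, X i u) P := Finset.aemeasurable_fun_sum _ fun i _ => hXm i
  have := Measure.isProbabilityMeasure_map hS
  refine ⟨_, ⟨ℝ, inferInstance, P, X, inferInstance, hXν, rfl⟩, ?_⟩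
  rw [VaR_eq_leftQuantile P hS, hT']
  by_contra! hlt
  have hcdf := (leftQuantile_le_iff (Measure.map (fun u => ∑ i, X i u) P) hp _).1 le_rfl
  set y := leftQuantile (Measure.map (fun u => ∑ i, X i u) P) p
  rw [cdf_eq_real, measureReal_def, Measure.map_apply_of_aemeasurable hS measurableSet_Iic,
    hP, Measure.restrict_apply₀' measurableSet_Ioo.nullMeasurableSet] at hcdf
  have hsub : (fun u => ∑ i, X i u) ⁻¹' Iic y ∩ Ioo 0 1 ⊆ Ioo 0 a := by
    rintro u ⟨hu, hu01⟩
    refine ⟨hu01.1, lt_of_not_ge fun hau => ?_⟩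
    have hge := sum_toIcoMod_ge (f := leftQuantile ν) hT
      ((monotoneOn_leftQuantile ν).mono fun x hx => ⟨ha.trans_le hx.1, haT ▸ hx.2⟩)
      (by
        rw [haT, integrableOn_Ioc_iff_integrableOn_Ioo]
        exact hQ.mono_set (Ioo_subset_Ioo_left ha.le)) hn u
    rw [haT] at hge
    have hu' : ∑ i, X i u ≤ y := hu
    simp only [hX, not_lt.2 hau, if_false] at hu'
    exact absurd (hge.trans hu') (not_le.2 hlt)
  have hvol := measure_mono (μ := volume) hsub
  have := ENNReal.toReal_mono (by simp) hvol
  rw [Real.volume_Ioo, sub_zero, ENNReal.toReal_ofReal ha.le] at this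
  linarith

/-- Quantitative lower bound for the worst-case VaR, uniform in the auxiliary level. -/
lemma le_sSup_VaRvals (ν : Measure ℝ) [IsProbabilityMeasure ν] (hν : Integrable id ν)
    {n : ℕ} (hn : 0 < n) {p : ℝ} (hp : p ∈ Ioo (0 : ℝ) 1) :
    n * ((1 - p)⁻¹ * ∫ t in Ioo p 1, leftQuantile ν t)
      - (n / (1 - p) * (∫ t in Ioo (1 - 1 / (n : ℝ)) 1, |leftQuantile ν t|)
        + |leftQuantile ν (p / 2)|) ≤ sSup (VaRvals ν n p) := by
  set Q := leftQuantile ν with hQdef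
  have hn' : (1 : ℝ) ≤ n := by exact_mod_cast hn
  have hn0 : (0 : ℝ) < n := by linarith
  have h1p : 0 < 1 - p := sub_pos.2 hp.2
  have hQ : IntegrableOn Q (Ioo 0 1) := integrableOn_comp_leftQuantile ν hν
  have hQ' : IntervalIntegrable Q volume 0 1 := by
    rw [intervalIntegrable_iff_integrableOn_Ioo_of_le zero_le_one]
    exact hQ
  have hQcc : IntegrableOn Q (uIcc 1 0) := by
    rw [uIcc_of_ge zero_le_one, integrableOn_Icc_iff_integrableOn_Ioo]
    exact hQ
  have hbdd : BddAbove (VaRvals ν n p) := ⟨_, fun r hr => VaRvals_le ν hν n hp hr⟩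
  set E := n / (1 - p) * (∫ t in Ioo (1 - 1 / (n : ℝ)) 1, |Q t|) + |Q (p / 2)| with hE
  have hprim : ContinuousOn (fun a => ∫ t in a..1, Q t) (uIcc 1 0) := by
    simp_rw [intervalIntegral.integral_symm (1 : ℝ)]
    exact (intervalIntegral.continuousOn_primitive_interval hQcc).neg
  have hcont : ContinuousAt (fun a => n * ((1 - a)⁻¹ * ∫ t in a..1, Q t) - E) p := by
    have h1 : ContinuousAt (fun a => ∫ t in a..1, Q t) p :=
      hprim.continuousAt (by rw [uIcc_of_ge zero_le_one]; exact Icc_mem_nhds hp.1 hp.2)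
    have h2 : ContinuousAt (fun a : ℝ => (1 - a)⁻¹) p :=
      (continuousAt_const.sub continuousAt_id).inv₀ h1p.ne'
    exact (continuousAt_const.mul (h2.mul h1)).sub continuousAt_const
  have hlim : Tendsto (fun a => n * ((1 - a)⁻¹ * ∫ t in a..1, Q t) - E) (𝓝[<] p)
      (𝓝 (n * ((1 - p)⁻¹ * ∫ t in p..1, Q t) - E)) := hcont.tendsto.mono_left nhdsWithin_le_nhds
  rw [intervalIntegral.integral_of_le hp.2.le, integral_Ioc_eq_integral_Ioo] at hlim
  refine le_of_tendsto hlim ?_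
  have hp2 : p / 2 < p := by linarith [hp.1]
  filter_upwards [Ioo_mem_nhdsLT hp2] with a ⟨hap2, hap⟩
  have ha : 0 < a := by linarith [hp.1]
  have h1a : 0 < 1 - a := by linarith
  obtain ⟨r, hr, hle⟩ := exists_VaRvals_ge ν hν hn hp ha hap
  refine le_trans ?_ (hle.trans (le_csSup hbdd hr))
  set c := 1 - (1 - a) / n with hc
  have hdle : (1 - a) / n ≤ 1 - a := div_le_self h1a.le hn'
  have hac : a ≤ c := by linarith
  have hc1 : c < 1 := by
    have : 0 < (1 - a) / n := by positivity
    linarith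
  have hcn : 1 - 1 / (n : ℝ) ≤ c := by
    have : (1 - a) / n ≤ 1 / n := by gcongr; linarith
    linarith
  have hn1 : 0 ≤ 1 - 1 / (n : ℝ) := by
    rw [sub_nonneg, div_le_one hn0]
    exact hn'
  have hsplit : (∫ t in a..1, Q t) = (∫ t in a..c, Q t) + ∫ t in c..1, Q t := by
    refine (intervalIntegral.integral_add_adjacent_intervals ?_ ?_).symm <;>
    refine hQ'.mono_set ?_
    · rw [uIcc_of_le hac, uIcc_of_le zero_le_one]
      exact Icc_subset_Icc ha.le hc1.le
    · rw [uIcc_of_le hc1.le, uIcc_of_le zero_le_one]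
      exact Icc_subset_Icc (ha.le.trans hac) le_rfl
  have habs : IntegrableOn (fun t => |Q t|) (Ioo (1 - 1 / (n : ℝ)) 1) :=
    (hQ.mono_set (Ioo_subset_Ioo_left hn1)).abs
  have htail : (∫ t in c..1, Q t) ≤ ∫ t in Ioo (1 - 1 / (n : ℝ)) 1, |Q t| := by
    rw [intervalIntegral.integral_of_le hc1.le, integral_Ioc_eq_integral_Ioo]
    calc ∫ t in Ioo c 1, Q t ≤ ∫ t in Ioo c 1, |Q t| :=
          integral_mono (hQ.mono_set (Ioo_subset_Ioo_left (ha.le.trans hac)))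
            (habs.mono_set (Ioo_subset_Ioo_left hcn)) fun t => le_abs_self _
      _ ≤ _ := setIntegral_mono_set habs (.of_forall fun t => abs_nonneg _)
          (Ioo_subset_Ioo_left hcn).eventuallyLE
  have hJ : 0 ≤ ∫ t in Ioo (1 - 1 / (n : ℝ)) 1, |Q t| := integral_nonneg fun t => abs_nonneg _
  have hQa : -|Q (p / 2)| ≤ Q a :=
    (neg_abs_le _).trans (monotoneOn_leftQuantile ν ⟨by linarith [hp.1], by linarith⟩
      ⟨ha, by linarith⟩ hap2.le)
  have htail' : n / (1 - a) * (∫ t in c..1, Q t)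
      ≤ n / (1 - p) * ∫ t in Ioo (1 - 1 / (n : ℝ)) 1, |Q t| :=
    calc n / (1 - a) * (∫ t in c..1, Q t)
        ≤ n / (1 - a) * ∫ t in Ioo (1 - 1 / (n : ℝ)) 1, |Q t| := by gcongr
      _ ≤ _ := by gcongr
  rw [hsplit, hE, ← mul_assoc, ← div_eq_mul_inv, mul_add]
  linarith

/-- Tail integrals of a function with finite `k`-th moment, by Jensen's inequality. -/
lemma isLittleO_tail_integral {f : ℝ → ℝ} {k : ℝ} (hk : 1 ≤ k) (hf : IntegrableOn f (Ioo 0 1))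
    (hfk : IntegrableOn (fun t => |f t| ^ k) (Ioo 0 1)) :
    (fun n : ℕ => n * ∫ t in Ioo (1 - 1 / (n : ℝ)) 1, |f t|)
      =o[atTop] fun n : ℕ => (n : ℝ) ^ (1 / k) := by
  have hk0 : 0 < k := by linarith
  set ε : ℕ → ℝ := fun n => ∫ t in Ioo (1 - 1 / (n : ℝ)) 1, |f t| ^ k with hε
  have hε0 : ∀ n, 0 ≤ ε n := fun n => integral_nonneg fun t => by positivity
  have hcc : IntegrableOn (fun t => |f t| ^ k) (uIcc 1 0) := by
    rw [uIcc_of_ge zero_le_one, integrableOn_Icc_iff_integrableOn_Ioo]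
    exact hfk
  have hεlim : Tendsto ε atTop (𝓝 0) := by
    have hprim := intervalIntegral.continuousOn_primitive_interval hcc
    have h1 := hprim 1 left_mem_uIcc
    have h2 : Tendsto (fun n : ℕ => 1 - 1 / (n : ℝ)) atTop (𝓝[uIcc 1 0] 1) := by
      refine tendsto_nhdsWithin_iff.2 ⟨?_, ?_⟩
      · simpa using tendsto_one_div_atTop_nhds_zero_nat.const_sub (1 : ℝ)
      · filter_upwards [eventually_ge_atTop 1] with n hn
        have hn' : (1 : ℝ) ≤ n := by exact_mod_cast hn
        rw [uIcc_of_ge zero_le_one]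
        refine ⟨?_, ?_⟩
        · rw [sub_nonneg, div_le_one (by linarith)]
          exact hn'
        · rw [sub_le_self_iff]
          positivity
    have h3 := (h1.tendsto.comp h2).neg
    rw [intervalIntegral.integral_same, neg_zero] at h3
    refine h3.congr fun n => ?_
    have : 1 - 1 / (n : ℝ) ≤ 1 := by
      rw [sub_le_self_iff]
      positivity
    simp only [Function.comp, hε]
    rw [← intervalIntegral.integral_symm, intervalIntegral.integral_of_le this,
      integral_Ioc_eq_integral_Ioo]
  have hbound : ∀ᶠ n : ℕ in atTop,
      ‖n * ∫ t in Ioo (1 - 1 / (n : ℝ)) 1, |f t|‖ ≤ ‖ε n ^ (1 / k) * (n : ℝ) ^ (1 / k)‖ := by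
    filter_upwards [eventually_ge_atTop 1] with n hn
    have hn' : (1 : ℝ) ≤ n := by exact_mod_cast hn
    have hn0 : (0 : ℝ) < n := by linarith
    have hn1 : 0 ≤ 1 - 1 / (n : ℝ) := by
      rw [sub_nonneg, div_le_one hn0]
      exact hn'
    have hsub : Ioo (1 - 1 / (n : ℝ)) 1 ⊆ Ioo 0 1 := Ioo_subset_Ioo_left hn1
    have hJ : 0 ≤ ∫ t in Ioo (1 - 1 / (n : ℝ)) 1, |f t| := integral_nonneg fun t => abs_nonneg _
    have hvol : volume.real (Ioo (1 - 1 / (n : ℝ)) 1) = (n : ℝ)⁻¹ := by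
      rw [Real.volume_real_Ioo_of_le (by rw [sub_le_self_iff]; positivity)]
      simp
    have hvol' : volume (Ioo (1 - 1 / (n : ℝ)) 1) ≠ 0 := by
      simp [hn0]
    have hjensen := (convexOn_rpow hk).map_set_average_le (μ := volume)
      (t := Ioo (1 - 1 / (n : ℝ)) 1) (f := fun t => |f t|)
      (Real.continuous_rpow_const hk0.le).continuousOn isClosed_Ici hvol' (by simp)
      (.of_forall fun t => mem_Ici.2 (abs_nonneg _)) (hf.mono_set hsub).abs (hfk.mono_set hsub)
    rw [setAverage_eq, setAverage_eq, hvol, inv_inv, smul_eq_mul, smul_eq_mul] at hjensen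
    rw [Real.norm_of_nonneg (by positivity),
      Real.norm_of_nonneg (mul_nonneg (Real.rpow_nonneg (hε0 n) _) (by positivity)),
      ← Real.mul_rpow (hε0 n) hn0.le, one_div k, Real.le_rpow_inv_iff_of_pos (by positivity)
        (mul_nonneg (hε0 n) hn0.le) hk0, mul_comm (ε n)]
    exact hjensen
  have hO : (fun n : ℕ => n * ∫ t in Ioo (1 - 1 / (n : ℝ)) 1, |f t|)
      =O[atTop] fun n : ℕ => ε n ^ (1 / k) * (n : ℝ) ^ (1 / k) :=
    IsBigO.of_bound 1 (hbound.mono fun n h => by rwa [one_mul])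
  refine hO.trans_isLittleO ?_
  have hlim : Tendsto (fun n => ε n ^ (1 / k)) atTop (𝓝 0) := by
    have := hεlim.rpow_const (p := 1 / k) (Or.inr (by positivity))
    rwa [Real.zero_rpow (by positivity)] at this
  simpa only [one_mul] using ((isLittleO_one_iff ℝ).2 hlim).mul_isBigO
    (isBigO_refl (fun n : ℕ => (n : ℝ) ^ (1 / k)) atTop)

/-- **Corollary 3.5.** Suppose `F` has finite `k`-th absolute moment, `k ≥ 1`, `X ∼ F`,
and `p ∈ (0,1)` is such that `TVaR_p(X) ≠ 0`. Then
`(sup_{S ∈ 𝔖_n} VaR_p(S)) / (sup_{S ∈ 𝔖_n} TVaR_p(S)) = 1 − o(n^{−1+1/k})`; in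
particular the worst-case VaR and worst-case TVaR are asymptotically equivalent. -/
theorem worst_VaR_TVaR_asymptotic_equivalence
    (ν : Measure ℝ) [IsProbabilityMeasure ν] (k : ℝ) (hk : 1 ≤ k)
    (hmom : Integrable (fun x : ℝ => |x| ^ k) ν)
    (p : ℝ) (hp : p ∈ Ioo (0:ℝ) 1)
    {Ω : Type*} [MeasurableSpace Ω] (P : Measure Ω) [IsProbabilityMeasure P]
    (X : Ω → ℝ) (hX : Measure.map X P = ν) (hT : TVaR P X p ≠ 0) :
    ((fun n : ℕ => 1 - sSup (VaRvals ν n p) / sSup (TVaRvals ν n p))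
      =o[atTop] fun n : ℕ => (n : ℝ) ^ (-1 + 1 / k)) ∧
    Tendsto (fun n : ℕ => sSup (VaRvals ν n p) / sSup (TVaRvals ν n p))
      atTop (nhds 1) := by
  have h1p : 0 < 1 - p := sub_pos.2 hp.2
  have hk0 : 0 < k := by linarith
  have hν : Integrable id ν := by
    refine ((integrable_const (1 : ℝ)).add hmom).mono' aestronglyMeasurable_id
      (.of_forall fun x => ?_)
    simp only [id, Real.norm_eq_abs, Pi.add_apply]
    rcases le_total |x| 1 with h | h
    · have : 0 ≤ |x| ^ k := by positivity
      linarith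
    · have := Real.self_le_rpow_of_one_le h hk
      linarith
  have hXm : AEMeasurable X P :=
    AEMeasurable.of_map_ne_zero (by rw [hX]; exact IsProbabilityMeasure.ne_zero ν)
  rw [TVaR_eq_integral P hXm hp, hX] at hT
  set τ := (1 - p)⁻¹ * ∫ t in Ioo p 1, leftQuantile ν t with hτ
  set E : ℕ → ℝ := fun n => n / (1 - p) * (∫ t in Ioo (1 - 1 / (n : ℝ)) 1, |leftQuantile ν t|)
    + |leftQuantile ν (p / 2)| with hE
  have hE0 : ∀ n, 0 ≤ E n := fun n =>
    add_nonneg (mul_nonneg (div_nonneg (Nat.cast_nonneg n) h1p.le)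
      (integral_nonneg fun t => abs_nonneg _)) (abs_nonneg _)
  have hpow : Tendsto (fun n : ℕ => (n : ℝ) ^ (1 / k)) atTop atTop :=
    (tendsto_rpow_atTop (by positivity)).comp tendsto_natCast_atTop_atTop
  have hEo : E =o[atTop] fun n : ℕ => (n : ℝ) ^ (1 / k) := by
    refine IsLittleO.add ?_ (isLittleO_const_left.2 (Or.inr (tendsto_norm_atTop_atTop.comp hpow)))
    refine ((isLittleO_tail_integral hk (integrableOn_comp_leftQuantile ν hν)
      (integrableOn_comp_leftQuantile ν hmom)).const_mul_left (1 - p)⁻¹).congr_left fun n => ?_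
    simp only [id]
    ring
  have hbound : ∀ᶠ n : ℕ in atTop,
      ‖1 - sSup (VaRvals ν n p) / sSup (TVaRvals ν n p)‖ ≤ |τ|⁻¹ * ‖(n : ℝ)⁻¹ * E n‖ := by
    filter_upwards [eventually_gt_atTop 0] with n hn
    have hn0 : (0 : ℝ) < n := by exact_mod_cast hn
    have hlow := le_sSup_VaRvals ν hν hn hp
    have hup : sSup (VaRvals ν n p) ≤ n * τ := by
      obtain ⟨r, hr, -⟩ := exists_VaRvals_ge ν hν hn hp (half_pos hp.1) (half_lt_self hp.1)
      exact csSup_le ⟨r, hr⟩ fun r hr => VaRvals_le ν hν n hp hr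
    rw [(isGreatest_TVaRvals ν hν hn hp).csSup_eq, ← hτ]
    have hne : (n : ℝ) * τ ≠ 0 := mul_ne_zero hn0.ne' hT
    have heq : 1 - sSup (VaRvals ν n p) / (n * τ)
        = τ⁻¹ * ((n : ℝ)⁻¹ * (n * τ - sSup (VaRvals ν n p))) := by
      field_simp
    rw [heq, norm_mul, norm_inv, Real.norm_eq_abs, norm_mul, norm_mul,
      Real.norm_of_nonneg (sub_nonneg.2 hup), Real.norm_of_nonneg (hE0 n)]
    gcongr
    linarith
  have hmain : (fun n : ℕ => 1 - sSup (VaRvals ν n p) / sSup (TVaRvals ν n p))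
      =o[atTop] fun n : ℕ => (n : ℝ) ^ (-1 + 1 / k) := by
    refine (IsBigO.of_bound _ hbound).trans_isLittleO ?_
    refine ((isBigO_refl (fun n : ℕ => (n : ℝ)⁻¹) atTop).mul_isLittleO hEo).congr' .rfl ?_
    filter_upwards [eventually_gt_atTop 0] with n hn
    rw [Real.rpow_add (by exact_mod_cast hn), Real.rpow_neg_one]
  refine ⟨hmain, ?_⟩
  have hO : (fun n : ℕ => (n : ℝ) ^ (-1 + 1 / k)) =O[atTop] fun _ => (1 : ℝ) := by
    refine IsBigO.of_bound 1 ?_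
    filter_upwards [eventually_ge_atTop 1] with n hn
    have hn' : (1 : ℝ) ≤ n := by exact_mod_cast hn
    rw [Real.norm_of_nonneg (by positivity), norm_one, one_mul]
    refine Real.rpow_le_one_of_one_le_of_nonpos hn' ?_
    have : 1 / k ≤ 1 := (div_le_one hk0).2 hk
    linarith
  have hlim := ((isLittleO_one_iff ℝ).1 (hmain.trans_isBigO hO)).const_sub 1
  simpa using hlim
end
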